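/- arXiv:1211.5568 — 3 statements merged into one kernel-verified Lean document; each statement's English description precedes it below -/
import Mathlib

section
/- Let C be a binary linear code of length n and let L be a subset of F_2^n such that (1) the zero vector belongs to L, and (2) whenever v belongs to L and v is a coset leader of C, then v + e_i belongs to L for every coordinate i not in supp(v). Then L contains every coset leader of C, i.e. CL(C) ⊆ L. -/
/-- `w` is a coset leader of the binary code `C`: it has minimal Hamming weight
in its coset `w + C`. -/
def IsCosetLeader {n : ℕ} (C : Submodule (ZMod 2) (Fin n → ZMod 2))
    (w : Fin n → ZMod 2) : Prop :=
  ∀ v : Fin n → ZMod 2, w - v ∈ C → hammingNorm w ≤ hammingNorm v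

theorem hammingNorm_add_single_of_apply_eq_zero {n : ℕ} {v : Fin n → ZMod 2} {i : Fin n}
    (hi : v i = 0) : hammingNorm (v + Pi.single i 1) = hammingNorm v + 1 := by
  unfold hammingNorm
  rw [← Finset.card_insert_of_notMem (a := i) (by simp [hi])]
  congr 1
  ext j
  by_cases hj : j = i
  · subst hj
    simp [hi]
  · simp [hj]

theorem hammingNorm_add_single_le {n : ℕ} (v : Fin n → ZMod 2) (i : Fin n) :
    hammingNorm (v + Pi.single i 1) ≤ hammingNorm v + 1 := by
  unfold hammingNorm
  refine (Finset.card_le_card ?_).trans (Finset.card_insert_le i _)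
  intro j
  by_cases hj : j = i <;> simp [hj]

theorem IsCosetLeader.of_add_single {n : ℕ} {C : Submodule (ZMod 2) (Fin n → ZMod 2)}
    {v : Fin n → ZMod 2} {i : Fin n} (hi : v i = 0)
    (h : IsCosetLeader C (v + Pi.single i 1)) : IsCosetLeader C v := by
  intro u hu
  have hle := h (u + Pi.single i 1) (by rwa [add_sub_add_right_eq_sub])
  rw [hammingNorm_add_single_of_apply_eq_zero hi] at hle
  exact Nat.le_of_succ_le_succ (hle.trans (hammingNorm_add_single_le u i))

theorem stmt_1 {n : ℕ} (C : Submodule (ZMod 2) (Fin n → ZMod 2))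
    (L : Set (Fin n → ZMod 2))
    (h0 : (0 : Fin n → ZMod 2) ∈ L)
    (hstep : ∀ v ∈ L, IsCosetLeader C v →
      ∀ i : Fin n, v i = 0 → v + Pi.single i 1 ∈ L) :
    {w : Fin n → ZMod 2 | IsCosetLeader C w} ⊆ L := by
  intro w hw
  induction hk : hammingNorm w generalizing w with
  | zero => rwa [hammingNorm_eq_zero.mp hk]
  | succ k ih =>
    obtain ⟨i, hi⟩ : ∃ i, w i ≠ 0 := by
      by_contra! hzero
      simp [show w = 0 from funext hzero] at hk
    obtain ⟨v, rfl⟩ : ∃ v, w = v + Pi.single i 1 := ⟨w - Pi.single i 1, by simp⟩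
    have hv : v i = 0 := by
      have hone := Fin.eq_one_of_ne_zero _ hi
      rw [Pi.add_apply, Pi.single_eq_same] at hone
      exact add_eq_right.mp hone
    have hlead : IsCosetLeader C v := IsCosetLeader.of_add_single hv hw
    rw [hammingNorm_add_single_of_apply_eq_zero hv] at hk
    exact hstep v (ih hlead (Nat.succ.inj hk)) hlead i hv
end

section
/- Let C be a binary linear code of length n and let Z be a subset of C \ {0} such that X(D(0)) ⊆ ∪_{z ∈ Z} D(z), and suppose Z is minimal with this property (i.e. for no proper subset Z' of Z does X(D(0)) ⊆ ∪_{z ∈ Z'} D(z) hold). Then Z ⊆ L(C), i.e. every element of Z is a leader codeword of C. -/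
/-- The set of leader codewords of `C`. -/
def leaderCodewords {n : ℕ} (C : Submodule (ZMod 2) (Fin n → ZMod 2)) :
    Set (Fin n → ZMod 2) :=
  {c | c ∈ C ∧ c ≠ 0 ∧ ∃ (n1 n2 : Fin n → ZMod 2) (i : Fin n),
    IsCosetLeader C n1 ∧ IsCosetLeader C n2 ∧ n1 i = 0 ∧
    c = n1 + n2 + Pi.single i 1}

/-- The Voronoi region of a codeword `c` of `C`. -/
def voronoi {n : ℕ} (C : Submodule (ZMod 2) (Fin n → ZMod 2))
    (c : Fin n → ZMod 2) : Set (Fin n → ZMod 2) :=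
  {y | ∀ c' ∈ C, hammingDist y c ≤ hammingDist y c'}

/-- `X(A)`: the set of words at Hamming distance exactly 1 from `A`. -/
noncomputable def distOneSet {n : ℕ} (A : Set (Fin n → ZMod 2)) :
    Set (Fin n → ZMod 2) :=
  {y | sInf {d : ℕ | ∃ a ∈ A, hammingDist y a = d} = 1}

theorem isCosetLeader_sub_of_mem_voronoi {n : ℕ} {C : Submodule (ZMod 2) (Fin n → ZMod 2)}
    {c y : Fin n → ZMod 2} (hc : c ∈ C) (hy : y ∈ voronoi C c) : IsCosetLeader C (y - c) := by
  intro v hv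
  have h := hy (y - v) (by simpa [sub_right_comm y c v] using C.add_mem hv hc)
  rw [hammingDist_comm y, hammingDist_comm y] at h
  simpa [hammingDist_eq_hammingNorm, neg_add_eq_sub] using h

theorem exists_eq_add_single_of_hammingDist_eq_one {n : ℕ} {x y : Fin n → ZMod 2}
    (h : hammingDist x y = 1) : ∃ i, x = y + Pi.single i 1 := by
  obtain ⟨i, hi⟩ := Finset.card_eq_one.mp h
  refine ⟨i, funext fun j => ?_⟩
  have hj : x j ≠ y j ↔ j = i := by
    simpa using Finset.ext_iff.mp hi j
  have h2 : ∀ a b : ZMod 2, a ≠ b → a = b + 1 := by decide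
  rcases eq_or_ne j i with rfl | hji
  · simpa using h2 _ _ (hj.mpr rfl)
  · simpa [hji] using hj

theorem hammingNorm_add_single_lt {n : ℕ} {a : Fin n → ZMod 2} {i : Fin n} (hi : a i ≠ 0) :
    hammingNorm (a + Pi.single i 1) < hammingNorm a := by
  have h2 : ∀ b : ZMod 2, b ≠ 0 → b + 1 = 0 := by decide
  refine Finset.card_lt_card (Finset.ssubset_iff_of_subset ?_ |>.mpr ⟨i, by simpa, ?_⟩)
  · intro j hj
    rcases eq_or_ne j i with rfl | hji
    · simpa
    · simpa [hji] using hj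
  · simpa using h2 _ hi

theorem add_single_mem_voronoi_zero {n : ℕ} {C : Submodule (ZMod 2) (Fin n → ZMod 2)}
    {a : Fin n → ZMod 2} (ha : a ∈ voronoi C 0) {i : Fin n} (hi : a i ≠ 0)
    (hd : hammingDist (a + Pi.single i 1) a = 1) : a + Pi.single i 1 ∈ voronoi C 0 := by
  intro c hc
  have h1 := ha c hc
  have h2 := hammingDist_triangle a (a + Pi.single i 1) c
  have h3 := hammingNorm_add_single_lt hi
  rw [hammingDist_comm] at hd
  simp only [hammingDist_zero_right] at h1 ⊢
  omega

theorem exists_of_mem_distOneSet {n : ℕ} {A : Set (Fin n → ZMod 2)} {y : Fin n → ZMod 2}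
    (hy : y ∈ distOneSet A) : y ∉ A ∧ ∃ a ∈ A, hammingDist y a = 1 := by
  have hs : sInf {d : ℕ | ∃ a ∈ A, hammingDist y a = d} = 1 := hy
  constructor
  · intro hyA
    have := Nat.sInf_le (s := {d : ℕ | ∃ a ∈ A, hammingDist y a = d})
      ⟨y, hyA, hammingDist_self y⟩
    omega
  · have hmem := Nat.sInf_mem (Nat.nonempty_of_pos_sInf (hs ▸ Nat.one_pos))
    rwa [hs] at hmem

theorem stmt_11 {n : ℕ} (C : Submodule (ZMod 2) (Fin n → ZMod 2))
    (Z : Set (Fin n → ZMod 2))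
    (hZC : ∀ z ∈ Z, z ∈ C ∧ z ≠ 0)
    (hcov : distOneSet (voronoi C 0) ⊆ ⋃ z ∈ Z, voronoi C z)
    (hmin : ∀ Z' ⊂ Z, ¬ (distOneSet (voronoi C 0) ⊆ ⋃ z ∈ Z', voronoi C z)) :
    Z ⊆ leaderCodewords C := by
  intro z hz
  obtain ⟨hzC, hz0⟩ := hZC z hz
  obtain ⟨y, hy, hyZ⟩ := Set.not_subset.mp (hmin (Z \ {z}) (Set.sdiff_singleton_ssubset.mpr hz))
  have hyz : y ∈ voronoi C z := by
    obtain ⟨w, hw, hyw⟩ := Set.mem_iUnion₂.mp (hcov hy)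
    rcases eq_or_ne w z with rfl | hwz
    · exact hyw
    · exact (hyZ (Set.mem_iUnion₂.mpr ⟨w, ⟨hw, hwz⟩, hyw⟩)).elim
  obtain ⟨hy0, a, ha, hd⟩ := exists_of_mem_distOneSet hy
  obtain ⟨i, rfl⟩ := exists_eq_add_single_of_hammingDist_eq_one hd
  refine ⟨hzC, hz0, a, a + Pi.single i 1 - z, i, ?_,
    isCosetLeader_sub_of_mem_voronoi hzC hyz, ?_, ?_⟩
  · simpa using isCosetLeader_sub_of_mem_voronoi C.zero_mem ha
  · by_contra hi
    exact hy0 (add_single_mem_voronoi_zero ha hi hd)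
  · have h2 : ∀ a b c : ZMod 2, c = a + (a + b - c) + b := by decide
    exact funext fun j => h2 _ _ _
end

section
/- Let C be a binary linear code of length n and let z1 ≠ z2 be two distinct coset leaders belonging to the same coset of C. Then z1 + z2 is a leader codeword of C, i.e. z1 + z2 ∈ L(C). -/
/-- Distinct binary words of equal weight: some coordinate lies in the support of the second word
but not of the first. -/
theorem exists_eq_zero_and_eq_one_of_hammingNorm_eq {ι : Type*} [Fintype ι] {x y : ι → ZMod 2}
    (hne : x ≠ y) (h : hammingNorm x = hammingNorm y) : ∃ i, x i = 0 ∧ y i = 1 := by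
  have eq_one_of_ne_zero : ∀ a : ZMod 2, a ≠ 0 → a = 1 := by decide
  by_contra! hxy
  have hsub : ({i | y i ≠ 0} : Finset ι) ⊆ ({i | x i ≠ 0} : Finset ι) := fun i hi => by
    simp only [Finset.mem_filter, Finset.mem_univ, true_and] at hi ⊢
    exact fun hx => hxy i hx (eq_one_of_ne_zero _ hi)
  have heq := Finset.eq_of_subset_of_card_le hsub h.le
  refine hne (funext fun i => ?_)
  have hi : y i ≠ 0 ↔ x i ≠ 0 := by simpa using congrArg (i ∈ ·) heq
  by_cases hx : x i = 0
  · rw [hx, not_ne_iff.mp (mt hi.mp (not_ne_iff.mpr hx))]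
  · rw [eq_one_of_ne_zero _ hx, eq_one_of_ne_zero _ (hi.mpr hx)]

theorem hammingNorm_add_le {ι : Type*} [Fintype ι] {β : ι → Type*} [∀ i, AddGroup (β i)]
    [∀ i, DecidableEq (β i)] (x y : ∀ i, β i) :
    hammingNorm (x + y) ≤ hammingNorm x + hammingNorm y := by
  classical
  refine (Finset.card_le_card fun i hi => ?_).trans (Finset.card_union_le _ _)
  simp only [Finset.mem_filter, Finset.mem_univ, true_and, Finset.mem_union, Pi.add_apply] at hi ⊢
  by_contra! h
  simp [h.1, h.2] at hi

theorem hammingNorm_single_le_one {ι : Type*} [Fintype ι] [DecidableEq ι] {β : ι → Type*}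
    [∀ i, Zero (β i)] [∀ i, DecidableEq (β i)] (i : ι) (a : β i) :
    hammingNorm (Pi.single i a) ≤ 1 := by
  refine (Finset.card_le_card (t := {i}) fun j hj => ?_).trans (Finset.card_singleton i).le
  by_contra hji
  simp_all

/-- Deleting a coordinate from the support of a coset leader gives a coset leader. -/
theorem IsCosetLeader.sub_single {n : ℕ} {C : Submodule (ZMod 2) (Fin n → ZMod 2)}
    {w : Fin n → ZMod 2} (hw : IsCosetLeader C w) {i : Fin n} (hi : w i = 1) :
    IsCosetLeader C (w - Pi.single i 1) := by
  intro v hv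
  have hle : hammingNorm w ≤ hammingNorm (v + Pi.single i 1) :=
    hw _ (by rwa [add_comm, ← sub_sub])
  have hlt : hammingNorm (w - Pi.single i 1) < hammingNorm w := by
    refine Finset.card_lt_card (Finset.ssubset_iff_of_subset (fun j hj => ?_) |>.mpr ⟨i, ?_, ?_⟩)
    · by_cases hji : j = i
      · subst hji
        simp [hi]
      · simpa [hji] using hj
    · simp [hi]
    · simp [hi]
  have hadd := hammingNorm_add_le v (Pi.single i 1)
  have hone := hammingNorm_single_le_one (β := fun _ : Fin n => ZMod 2) i 1
  omega

theorem stmt_13 {n : ℕ} (C : Submodule (ZMod 2) (Fin n → ZMod 2))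
    (z1 z2 : Fin n → ZMod 2) (hne : z1 ≠ z2)
    (h1 : IsCosetLeader C z1) (h2 : IsCosetLeader C z2)
    (hcoset : z1 - z2 ∈ C) :
    z1 + z2 ∈ leaderCodewords C := by
  have hcoset' : z2 - z1 ∈ C := by simpa using C.neg_mem hcoset
  obtain ⟨i, hi1, hi2⟩ := exists_eq_zero_and_eq_one_of_hammingNorm_eq hne
    (le_antisymm (h1 z2 hcoset) (h2 z1 hcoset'))
  have hadd : z1 + z2 = z1 - z2 := funext fun j => (CharTwo.sub_eq_add (z1 j) (z2 j)).symm
  refine ⟨hadd ▸ hcoset, ?_, z1, z2 - Pi.single i 1, i, h1, h2.sub_single hi2, hi1, ?_⟩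
  · rwa [hadd, sub_ne_zero]
  · rw [add_assoc, sub_add_cancel]
end
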